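/- Let Λ ⊆ ℂ be a lattice, let s ∈ ℂ satisfy ns ∉ Λ for every integer n ≥ 1, let R be a pinning, and let f be an elliptic function for Λ. Then the derivative f' is elliptically summable if and only if Σ_{n∈ℤ} c_k(f, r+ns) = 0 for every r ∈ R and every k ≥ 1. -/

import Mathlib

open Filter Topology Set

/-- The Weierstrass zeta function of a lattice `L ⊆ ℂ`. -/
noncomputable def wzeta (L : Set ℂ) (z : ℂ) : ℂ :=
  1 / z + ∑' l : ↥(L \ {0}), (1 / (z - (l : ℂ)) + 1 / (l : ℂ) + z / (l : ℂ) ^ 2)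

/-- `L` is a lattice in `ℂ`. -/
def IsLattice (L : Set ℂ) : Prop :=
  ∃ ω₁ ω₂ : ℂ, LinearIndependent ℝ ![ω₁, ω₂] ∧
    L = {z : ℂ | ∃ m n : ℤ, z = (m : ℂ) * ω₁ + (n : ℂ) * ω₂}

/-- `F` extends analytically to the point `α`. -/
def ExtAnalyticAt (F : ℂ → ℂ) (α : ℂ) : Prop :=
  ∃ g : ℂ → ℂ, AnalyticAt ℂ g α ∧ ∀ᶠ z in 𝓝[≠] α, F z = g z

/-- `f` is an elliptic function for the lattice `L`: meromorphic on `ℂ` and `L`-periodic. -/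
def IsElliptic (L : Set ℂ) (f : ℂ → ℂ) : Prop :=
  MeromorphicOn f Set.univ ∧
    ∀ lam ∈ L, ∀ z : ℂ, AnalyticAt ℂ f z → f (z + lam) = f z

/-- `c : ℕ → ℂ` is the family of principal part coefficients of `f` at `α`
(`c k` is the coefficient of `1/(z-α)^k`; `c 0` is irrelevant and set to `0`). -/
def IsPrincPart (f : ℂ → ℂ) (α : ℂ) (c : ℕ → ℂ) : Prop :=
  c 0 = 0 ∧ (Function.support c).Finite ∧
    ExtAnalyticAt (fun z => f z - ∑ᶠ k : ℕ, c k / (z - α) ^ k) α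

/-- `R` is a pinning: `(r, n, λ) ↦ r + n s + λ` is a bijection from `R × ℤ × L` onto `ℂ`. -/
def IsPinning (L : Set ℂ) (s : ℂ) (R : Set ℂ) : Prop :=
  ∀ z : ℂ, ∃! p : ℂ × ℤ × ℂ, p.1 ∈ R ∧ p.2.2 ∈ L ∧ z = p.1 + (p.2.1 : ℂ) * s + p.2.2


/-- `f` is elliptically summable: `f = τ(g) − g` for some elliptic `g`,
where `τ(g)(z) = g(z+s)`. -/
def EllSummable (L : Set ℂ) (s : ℂ) (f : ℂ → ℂ) : Prop :=
  ∃ g : ℂ → ℂ, IsElliptic L g ∧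
    ∀ z : ℂ, AnalyticAt ℂ g z → AnalyticAt ℂ g (z + s) → f z = g (z + s) - g z

namespace PeriodPair

variable (Λ : PeriodPair)

lemma norm_zetaTerm_le {r : ℝ} (hr : 0 < r) {z l : ℂ} (hz : ‖z‖ < r) (h : 2 * r ≤ ‖l‖) :
    ‖1 / (z - l) + 1 / l + z / l ^ 2‖ ≤ 2 * r ^ 2 * ‖l‖ ^ (-3 : ℝ) := by
  have hzl : z ≠ l := by rintro rfl; linarith
  have hl : 0 < ‖l‖ := by linarith
  have hl0 : l ≠ 0 := norm_pos_iff.mp hl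
  have hd : ‖l‖ / 2 ≤ ‖z - l‖ := by
    rw [norm_sub_rev]
    exact .trans (by linarith) (norm_sub_norm_le l z)
  have key : 1 / (z - l) + 1 / l + z / l ^ 2 = z ^ 2 / ((z - l) * l ^ 2) := by
    have := sub_ne_zero.mpr hzl
    field_simp
    ring
  rw [key, norm_div, norm_mul, norm_pow, norm_pow]
  calc ‖z‖ ^ 2 / (‖z - l‖ * ‖l‖ ^ 2) ≤ r ^ 2 / (‖l‖ / 2 * ‖l‖ ^ 2) := by gcongr
    _ = 2 * r ^ 2 / ‖l‖ ^ 3 := by field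
    _ = _ := by norm_cast

/-- The Weierstrass zeta function with its pole at the origin removed. -/
noncomputable def zetaExcept (z : ℂ) : ℂ :=
  ∑' l : Λ.lattice, if l.1 = 0 then 0 else (1 / (z - l) + 1 / l + z / (l : ℂ) ^ 2)

lemma hasSumLocallyUniformly_zetaExcept :
    HasSumLocallyUniformly
      (fun (l : Λ.lattice) (z : ℂ) ↦
        if l.1 = 0 then 0 else (1 / (z - l) + 1 / l + z / (l : ℂ) ^ 2))
      Λ.zetaExcept := by
  refine Λ.hasSumLocallyUniformly_aux (u := (2 * · ^ 2 * ‖·‖ ^ (-3 : ℝ))) _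
    (fun _ _ ↦ (ZLattice.summable_norm_rpow _ _ (by simp; norm_num)).mul_left _) fun r hr ↦
    Filter.eventually_atTop.mpr ⟨2 * r, ?_⟩
  rintro _ h s hs l rfl
  split_ifs
  · simpa using! show 0 ≤ 2 * r ^ 2 * (‖(l : ℂ)‖ ^ 3)⁻¹ by positivity
  · exact norm_zetaTerm_le hr hs h

lemma hasDerivAt_zetaTerm {z l : ℂ} (hz : z - l ≠ 0) :
    HasDerivAt (fun z : ℂ ↦ 1 / (z - l) + 1 / l + z / l ^ 2)
      (-(1 / (z - l) ^ 2 - 1 / l ^ 2)) z := by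
  have h1 : HasDerivAt (fun z : ℂ ↦ 1 / (z - l)) (-(1 / (z - l) ^ 2)) z := by
    simpa [one_div, neg_div] using ((hasDerivAt_id' z).sub_const l).fun_inv hz
  refine ((h1.add_const (1 / l)).add ((hasDerivAt_id' z).div_const (l ^ 2))).congr_deriv ?_
  ring

lemma sub_ne_zero_of_notMem_lattice_sdiff {z : ℂ} (hz : z ∈ ((Λ.lattice : Set ℂ) \ {0})ᶜ)
    (l : Λ.lattice) (hl : ¬ l.1 = 0) : z - l ≠ 0 := by
  intro e
  exact hz (sub_eq_zero.mp e ▸ ⟨l.2, hl⟩)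

lemma differentiableOn_zetaTerm (l : Λ.lattice) :
    DifferentiableOn ℂ (fun z : ℂ ↦
      if l.1 = 0 then 0 else (1 / (z - l) + 1 / l + z / (l : ℂ) ^ 2))
      ((Λ.lattice : Set ℂ) \ {0})ᶜ := by
  intro z hz
  split_ifs with hl
  · exact differentiableWithinAt_const _
  · exact (hasDerivAt_zetaTerm
      (Λ.sub_ne_zero_of_notMem_lattice_sdiff hz l hl)).differentiableAt.differentiableWithinAt

lemma differentiableOn_zetaExcept :
    DifferentiableOn ℂ Λ.zetaExcept ((Λ.lattice : Set ℂ) \ {0})ᶜ :=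
  Λ.hasSumLocallyUniformly_zetaExcept.hasSumLocallyUniformlyOn.differentiableOn
    (.of_forall fun _ ↦ .fun_sum fun i _ ↦ Λ.differentiableOn_zetaTerm i)
    Λ.isOpen_compl_lattice_sdiff

lemma eqOn_deriv_zetaExcept :
    Set.EqOn (deriv Λ.zetaExcept) (fun z ↦ -Λ.weierstrassPExcept 0 z)
      ((Λ.lattice : Set ℂ) \ {0})ᶜ := by
  refine (Λ.hasSumLocallyUniformly_zetaExcept.tendstoLocallyUniformlyOn.deriv
    (.of_forall fun s ↦ .fun_sum fun i _ ↦ Λ.differentiableOn_zetaTerm i)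
    Λ.isOpen_compl_lattice_sdiff).unique ?_
  refine (Λ.hasSumLocallyUniformly_weierstrassPExcept 0).tendstoLocallyUniformlyOn.neg.congr ?_
  intro s z hz
  simp only [Function.comp_apply, Pi.neg_apply]
  rw [deriv_fun_sum]
  · rw [← Finset.sum_neg_distrib]
    refine Finset.sum_congr rfl fun l _ ↦ ?_
    split_ifs with hl
    · simp
    · exact (hasDerivAt_zetaTerm (Λ.sub_ne_zero_of_notMem_lattice_sdiff hz l hl)).deriv.symm
  · exact fun l _ ↦ (Λ.differentiableOn_zetaTerm l).differentiableAt
      (Λ.isOpen_compl_lattice_sdiff.mem_nhds hz)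

/-- The Weierstrass zeta function. -/
noncomputable def zeta (z : ℂ) : ℂ := 1 / z + Λ.zetaExcept z

lemma analyticAt_zetaExcept_zero : AnalyticAt ℂ Λ.zetaExcept 0 :=
  Λ.differentiableOn_zetaExcept.analyticAt (Λ.compl_lattice_sdiff_singleton_mem_nhds 0)

lemma hasDerivAt_zeta {z : ℂ} (hz : z ∉ Λ.lattice) :
    HasDerivAt Λ.zeta (-Λ.weierstrassP z) z := by
  have hz' : z ∈ ((Λ.lattice : Set ℂ) \ {0})ᶜ := fun h ↦ hz h.1
  have hz0 : z ≠ 0 := fun h ↦ hz (h ▸ Λ.lattice.zero_mem)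
  have h1 : HasDerivAt (fun z : ℂ ↦ 1 / z) (-(1 / z ^ 2)) z := by
    simpa [one_div] using hasDerivAt_inv hz0
  have h2 := (Λ.differentiableOn_zetaExcept.differentiableAt
    (Λ.isOpen_compl_lattice_sdiff.mem_nhds hz')).hasDerivAt
  rw [Λ.eqOn_deriv_zetaExcept hz'] at h2
  refine (h1.add h2).congr_deriv ?_
  rw [← Λ.weierstrassPExcept_add 0]
  simp [add_comm]

lemma isOpen_compl_lattice : IsOpen ((Λ.lattice : Set ℂ)ᶜ) := Λ.isClosed_lattice.isOpen_compl

lemma isPreconnected_compl_lattice : IsPreconnected ((Λ.lattice : Set ℂ)ᶜ) := by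
  have hc : (Λ.lattice : Set ℂ).Countable := by
    have : Countable Λ.lattice := Λ.latticeEquivProd.toEquiv.countable_iff.mpr inferInstance
    exact Set.countable_coe_iff.mp this
  exact (hc.isPathConnected_compl_of_one_lt_rank
    (by rw [Complex.rank_real_complex]; norm_num)).isConnected.isPreconnected

lemma exists_zeta_quasiPeriod {l : ℂ} (hl : l ∈ Λ.lattice) :
    ∃ η : ℂ, ∀ z ∉ Λ.lattice, Λ.zeta (z + l) = Λ.zeta z + η := by
  have hd : ∀ z ∉ Λ.lattice, HasDerivAt (fun z ↦ Λ.zeta (z + l) - Λ.zeta z) 0 z := by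
    intro z hz
    have hzl : z + l ∉ Λ.lattice := fun h ↦ hz (by simpa using sub_mem h hl)
    have := ((Λ.hasDerivAt_zeta hzl).comp_add_const z l).sub (Λ.hasDerivAt_zeta hz)
    rwa [Λ.weierstrassP_add_coe z ⟨l, hl⟩, sub_self] at this
  obtain ⟨η, hη⟩ := Λ.isOpen_compl_lattice.exists_is_const_of_deriv_eq_zero
    Λ.isPreconnected_compl_lattice
    (fun z hz ↦ (hd z hz).differentiableAt.differentiableWithinAt) (fun z hz ↦ (hd z hz).deriv)
  exact ⟨η, fun z hz ↦ by rw [← hη z hz]; ring⟩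

end PeriodPair

open Polynomial

section PrincipalPart

variable {f g : ℂ → ℂ} {α : ℂ} {P Q : ℂ[X]}

lemma AnalyticAt.extAnalyticAt (hf : AnalyticAt ℂ f α) : ExtAnalyticAt f α :=
  ⟨f, hf, .of_forall fun _ ↦ rfl⟩

lemma ExtAnalyticAt.congr (hf : ExtAnalyticAt f α) (h : f =ᶠ[𝓝[≠] α] g) : ExtAnalyticAt g α := by
  obtain ⟨u, hu, hfu⟩ := hf
  exact ⟨u, hu, h.symm.trans hfu⟩

lemma ExtAnalyticAt.add (hf : ExtAnalyticAt f α) (hg : ExtAnalyticAt g α) :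
    ExtAnalyticAt (fun z ↦ f z + g z) α := by
  obtain ⟨u, hu, hfu⟩ := hf
  obtain ⟨v, hv, hgv⟩ := hg
  exact ⟨u + v, hu.add hv, Filter.EventuallyEq.add hfu hgv⟩

lemma ExtAnalyticAt.const_mul (hf : ExtAnalyticAt f α) (a : ℂ) :
    ExtAnalyticAt (fun z ↦ a * f z) α := by
  obtain ⟨u, hu, hfu⟩ := hf
  refine ⟨fun z ↦ a * u z, analyticAt_const.mul hu, ?_⟩
  filter_upwards [hfu] with z hz using by rw [hz]

lemma tendsto_add_const_nhdsNE (α s : ℂ) : Tendsto (· + s) (𝓝[≠] α) (𝓝[≠] (α + s)) :=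
  tendsto_nhdsWithin_of_tendsto_nhds_of_eventually_within _
    ((continuous_add_const s).tendsto α |>.mono_left nhdsWithin_le_nhds)
    (eventually_mem_nhdsWithin.mono fun z hz ↦ by simpa using hz)

lemma ExtAnalyticAt.comp_add_const {s : ℂ} (hf : ExtAnalyticAt f (α + s)) :
    ExtAnalyticAt (fun z ↦ f (z + s)) α := by
  obtain ⟨u, hu, hfu⟩ := hf
  refine ⟨fun z ↦ u (z + s), ?_, (tendsto_add_const_nhdsNE α s).eventually hfu⟩
  exact AnalyticAt.fun_comp (g := u) hu (by fun_prop)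

lemma Filter.EventuallyEq.deriv_nhdsNE (h : f =ᶠ[𝓝[≠] α] g) : deriv f =ᶠ[𝓝[≠] α] deriv g := by
  filter_upwards [eventually_eventually_nhdsWithin.mpr h, self_mem_nhdsWithin] with z hz hzα
  refine Filter.EventuallyEq.deriv_eq ?_
  rwa [isOpen_compl_singleton.nhdsWithin_eq hzα] at hz

lemma ExtAnalyticAt.deriv (hf : ExtAnalyticAt f α) : ExtAnalyticAt (deriv f) α := by
  obtain ⟨u, hu, hfu⟩ := hf
  exact ⟨_, hu.deriv, Filter.EventuallyEq.deriv_nhdsNE hfu⟩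

/-- The singular part of `f` at `α` is `P (1 / (z - α))`, up to a constant. -/
def HasPP (f : ℂ → ℂ) (α : ℂ) (P : ℂ[X]) : Prop :=
  ExtAnalyticAt (fun z ↦ f z - P.eval (z - α)⁻¹) α

lemma hasPP_zero : HasPP f α 0 ↔ ExtAnalyticAt f α := by simp [HasPP]

lemma HasPP.congr (hf : HasPP f α P) (h : f =ᶠ[𝓝[≠] α] g) : HasPP g α P :=
  ExtAnalyticAt.congr hf (by filter_upwards [h] with z hz using by rw [hz])

lemma HasPP.add (hf : HasPP f α P) (hg : HasPP g α Q) :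
    HasPP (fun z ↦ f z + g z) α (P + Q) :=
  (ExtAnalyticAt.add hf hg).congr (.of_forall fun z ↦ by simp only [eval_add]; ring)

lemma HasPP.const_mul (hf : HasPP f α P) (a : ℂ) : HasPP (fun z ↦ a * f z) α (a • P) :=
  (ExtAnalyticAt.const_mul hf a).congr
    (.of_forall fun z ↦ by simp only [eval_smul, smul_eq_mul]; ring)

lemma HasPP.sub (hf : HasPP f α P) (hg : HasPP g α Q) :
    HasPP (fun z ↦ f z - g z) α (P - Q) := by
  have := hf.add (hg.const_mul (-1))
  simpa [sub_eq_add_neg] using this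

lemma HasPP.sum {ι : Type*} {s : Finset ι} {F : ι → ℂ → ℂ} {p : ι → ℂ[X]}
    (h : ∀ i ∈ s, HasPP (F i) α (p i)) : HasPP (fun z ↦ ∑ i ∈ s, F i z) α (∑ i ∈ s, p i) := by
  classical
  induction s using Finset.induction with
  | empty => simpa [hasPP_zero] using (analyticAt_const (v := (0 : ℂ))).extAnalyticAt
  | insert i s hi ih =>
    simp only [Finset.sum_insert hi]
    exact (h i (by simp)).add (ih fun j hj ↦ h j (by simp [hj]))

lemma HasPP.comp_add_const {s : ℂ} (hf : HasPP f (α + s) P) : HasPP (fun z ↦ f (z + s)) α P :=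
  (ExtAnalyticAt.comp_add_const hf).congr (.of_forall fun z ↦ by simp)

lemma HasPP.comp_sub_const {s : ℂ} (hf : HasPP f α P) : HasPP (fun z ↦ f (z - s)) (α + s) P := by
  have : HasPP f (α + s + -s) P := by simpa using hf
  simpa [sub_eq_add_neg] using this.comp_add_const

lemma hasDerivAt_eval_inv (P : ℂ[X]) {z α : ℂ} (hz : z ≠ α) :
    HasDerivAt (fun z ↦ P.eval (z - α)⁻¹) ((-(X ^ 2 * derivative P)).eval (z - α)⁻¹) z := by
  have h1 : HasDerivAt (fun z : ℂ ↦ (z - α)⁻¹) (-1 / (z - α) ^ 2) z :=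
    ((hasDerivAt_id' z).sub_const α).fun_inv (sub_ne_zero.mpr hz)
  refine ((P.hasDerivAt _).comp z h1).congr_deriv ?_
  simp only [eval_neg, eval_mul, eval_pow, eval_X]
  field

lemma HasPP.deriv (hf : HasPP f α P) (hm : ∀ᶠ z in 𝓝[≠] α, DifferentiableAt ℂ f z) :
    HasPP (deriv f) α (-(X ^ 2 * derivative P)) := by
  refine ExtAnalyticAt.congr (ExtAnalyticAt.deriv hf) ?_
  filter_upwards [hm, self_mem_nhdsWithin] with z hz hzα
  exact (hz.hasDerivAt.sub (hasDerivAt_eval_inv P hzα)).deriv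

lemma HasPP.natDegree_eq_zero (h : HasPP f α P) (hf : ExtAnalyticAt f α) : P.natDegree = 0 := by
  by_contra hP
  have ht : Tendsto (fun z ↦ ‖(z - α)⁻¹‖) (𝓝[≠] α) atTop := by
    have : Tendsto (fun z ↦ ‖z - α‖) (𝓝[≠] α) (𝓝[>] 0) := by
      simpa using tendsto_norm_sub_self_nhdsNE α
    simpa only [norm_inv] using! this.inv_tendsto_nhdsGT_zero
  have h1 := P.tendsto_norm_atTop (natDegree_pos_iff_degree_pos.mp (Nat.pos_of_ne_zero hP)) ht
  obtain ⟨w, hw, hfw⟩ := hf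
  obtain ⟨v, hv, hv'⟩ := h
  have h2 : Tendsto (fun z ↦ P.eval (z - α)⁻¹) (𝓝[≠] α) (𝓝 (w α - v α)) := by
    refine ((hw.continuousAt.tendsto.sub hv.continuousAt.tendsto).mono_left
      nhdsWithin_le_nhds).congr' ?_
    filter_upwards [hfw, hv'] with z h1 h2
    rw [← h1, ← h2]; ring
  exact not_tendsto_nhds_of_tendsto_atTop h1 _ h2.norm

lemma HasPP.coeff_eq (hP : HasPP f α P) (hQ : HasPP f α Q) {k : ℕ} (hk : k ≠ 0) :
    P.coeff k = Q.coeff k := by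
  have h := (hP.sub hQ).natDegree_eq_zero
    ((analyticAt_const (v := (0 : ℂ))).extAnalyticAt.congr (.of_forall fun z ↦ by simp))
  have := coeff_eq_zero_of_natDegree_lt (p := P - Q) (n := k) (by omega)
  rwa [coeff_sub, sub_eq_zero] at this

lemma HasPP.unique (hP : HasPP f α P) (hQ : HasPP f α Q) (hP0 : P.coeff 0 = 0)
    (hQ0 : Q.coeff 0 = 0) : P = Q := by
  ext k
  rcases eq_or_ne k 0 with rfl | hk
  · rw [hP0, hQ0]
  · exact hP.coeff_eq hQ hk

lemma AnalyticAt.exists_hasPP_inv_pow_mul (n : ℕ) {h : ℂ → ℂ} (hh : AnalyticAt ℂ h α) :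
    ∃ P : ℂ[X], P.coeff 0 = 0 ∧ HasPP (fun z ↦ (z - α)⁻¹ ^ n * h z) α P := by
  induction n generalizing h with
  | zero => exact ⟨0, by simp, hasPP_zero.mpr (by simpa using hh.extAnalyticAt)⟩
  | succ n ih =>
    have hd : AnalyticAt ℂ (dslope h α) α := by
      obtain ⟨p, hp⟩ := hh
      exact ⟨_, hp.has_fpower_series_dslope_fslope⟩
    obtain ⟨P, hP0, hP⟩ := ih hd
    refine ⟨P + monomial (n + 1) (h α), by simp [hP0, coeff_monomial], ExtAnalyticAt.congr hP ?_⟩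
    filter_upwards [self_mem_nhdsWithin] with z hz
    have hz' : z - α ≠ 0 := sub_ne_zero.mpr hz
    have := sub_smul_dslope h α z
    rw [smul_eq_mul] at this
    simp only [eval_add, eval_monomial]
    rw [← sub_add_cancel (h z) (h α), ← this, pow_succ]
    linear_combination -(z - α)⁻¹ ^ n * dslope h α z * inv_mul_cancel₀ hz'

lemma MeromorphicAt.exists_hasPP (hf : MeromorphicAt f α) :
    ∃ P : ℂ[X], P.coeff 0 = 0 ∧ HasPP f α P := by
  obtain ⟨n, hn⟩ := hf
  obtain ⟨P, hP0, hP⟩ := hn.exists_hasPP_inv_pow_mul n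
  refine ⟨P, hP0, hP.congr ?_⟩
  filter_upwards [self_mem_nhdsWithin] with z hz
  have hz' : z - α ≠ 0 := sub_ne_zero.mpr hz
  rw [smul_eq_mul, ← mul_assoc, ← mul_pow, inv_mul_cancel₀ hz', one_pow, one_mul]

lemma IsPrincPart.exists_hasPP {c : ℕ → ℂ} (hc : IsPrincPart f α c) :
    ∃ P : ℂ[X], (∀ k, P.coeff k = c k) ∧ HasPP f α P := by
  obtain ⟨-, hfin, h⟩ := hc
  refine ⟨∑ k ∈ hfin.toFinset, monomial k (c k), fun k ↦ ?_, h.congr (.of_forall fun z ↦ ?_)⟩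
  · simp only [finsetSum_coeff, coeff_monomial]
    rw [Finset.sum_ite_eq' hfin.toFinset k]
    simp +contextual [eq_comm]
  · dsimp only
    rw [eval_finsetSum, finsum_eq_sum_of_support_subset (s := hfin.toFinset)]
    · simp [div_eq_mul_inv]
    · intro k hk
      simp only [Finite.coe_toFinset, Function.mem_support] at hk ⊢
      rintro h0
      simp [h0] at hk

end PrincipalPart

namespace PeriodPair

variable (Λ : PeriodPair)

lemma eventually_sub_notMem_lattice (α β : ℂ) : ∀ᶠ z in 𝓝[≠] α, z - β ∉ Λ.lattice := by
  have h := (tendsto_add_const_nhdsNE α (-β)).eventually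
    (inter_mem_nhdsWithin _ (Λ.compl_lattice_sdiff_singleton_mem_nhds (α + -β)))
  filter_upwards [h] with z hz hzl
  exact hz.2 ⟨by simpa [sub_eq_add_neg] using hzl, hz.1⟩

/-- The derivative of `zetaPow`. -/
noncomputable def derivZetaPow : ℕ → ℂ → ℂ
  | 0 => fun _ ↦ 0
  | 1 => fun z ↦ -Λ.weierstrassP z
  | k + 2 => fun z ↦ -(1 / (k + 1)) * deriv (derivZetaPow (k + 1)) z

/-- For `k ≥ 1`, the function with singular part `1 / z ^ k` at the origin obtained by
differentiating the Weierstrass zeta function. -/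
noncomputable def zetaPow : ℕ → ℂ → ℂ
  | 0 => fun _ ↦ 0
  | 1 => Λ.zeta
  | k + 2 => fun z ↦ -(1 / (k + 1)) * Λ.derivZetaPow (k + 1) z

lemma derivZetaPow_add (k : ℕ) (z : ℂ) {l : ℂ} (hl : l ∈ Λ.lattice) :
    Λ.derivZetaPow k (z + l) = Λ.derivZetaPow k z := by
  induction k using Nat.twoStepInduction generalizing z with
  | zero => rfl
  | one => simp only [derivZetaPow]; rw [Λ.weierstrassP_add_coe z ⟨l, hl⟩]
  | more k _ ih =>
    simp only [derivZetaPow]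
    rw [← deriv_comp_add_const, funext ih]

lemma meromorphicAt_derivZetaPow (k : ℕ) (z : ℂ) : MeromorphicAt (Λ.derivZetaPow k) z := by
  induction k using Nat.twoStepInduction with
  | zero => exact .const _ _
  | one => exact (Λ.meromorphic_weierstrassP z).neg
  | more k _ ih => exact (MeromorphicAt.const _ _).mul ih.deriv

lemma analyticAt_derivZetaPow (k : ℕ) {z : ℂ} (hz : z ∉ Λ.lattice) :
    AnalyticAt ℂ (Λ.derivZetaPow k) z := by
  induction k using Nat.twoStepInduction with
  | zero => exact analyticAt_const
  | one => exact (Λ.analyticOnNhd_weierstrassP z hz).neg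
  | more k _ ih => exact analyticAt_const.mul ih.deriv

lemma hasDerivAt_zetaPow (k : ℕ) {z : ℂ} (hz : z ∉ Λ.lattice) :
    HasDerivAt (Λ.zetaPow k) (Λ.derivZetaPow k z) z :=
  match k with
  | 0 => hasDerivAt_const z 0
  | 1 => Λ.hasDerivAt_zeta hz
  | k + 2 => (Λ.analyticAt_derivZetaPow (k + 1) hz).differentiableAt.hasDerivAt.const_mul _

lemma hasPP_zetaPow (k : ℕ) : HasPP (Λ.zetaPow k) 0 (X ^ k) := by
  induction k using Nat.twoStepInduction with
  | zero => exact AnalyticAt.extAnalyticAt (by simp only [zetaPow, pow_zero, eval_one]; fun_prop)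
  | one =>
    refine Λ.analyticAt_zetaExcept_zero.extAnalyticAt.congr (.of_forall fun z ↦ ?_)
    simp [zetaPow, zeta]
  | more k _ ih =>
    have hn : ∀ᶠ z in 𝓝[≠] (0 : ℂ), z ∉ Λ.lattice := by
      simpa using Λ.eventually_sub_notMem_lattice 0 0
    have h := ((ih.deriv (hn.mono fun z hz ↦
      (Λ.hasDerivAt_zetaPow (k + 1) hz).differentiableAt)).const_mul (-(1 / (k + 1)))).congr
      (g := Λ.zetaPow (k + 2))
      (hn.mono fun z hz ↦ by dsimp only; rw [(Λ.hasDerivAt_zetaPow (k + 1) hz).deriv]; rfl)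
    convert h using 1
    have hk : (k : ℂ) + 1 ≠ 0 := by exact_mod_cast k.succ_ne_zero
    rw [derivative_X_pow, smul_eq_C_mul, mul_neg, ← neg_mul, ← C_neg, neg_neg, mul_left_comm,
      ← mul_assoc (C _), ← C_mul, Nat.cast_succ, one_div_mul_cancel hk, C_1, one_mul,
      Nat.add_sub_cancel, ← pow_add, add_comm]

/-- The linear combination of the functions `zetaPow` with singular part `P (1 / z)` at the
origin. -/
noncomputable def zetaPoly : ℂ[X] →ₗ[ℂ] (ℂ → ℂ) :=
  Polynomial.lsum fun k ↦ LinearMap.toSpanSingleton ℂ (ℂ → ℂ) (Λ.zetaPow k)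

/-- The derivative of `zetaPoly`. -/
noncomputable def derivZetaPoly : ℂ[X] →ₗ[ℂ] (ℂ → ℂ) :=
  Polynomial.lsum fun k ↦ LinearMap.toSpanSingleton ℂ (ℂ → ℂ) (Λ.derivZetaPow k)

lemma zetaPoly_monomial (k : ℕ) (a : ℂ) :
    Λ.zetaPoly (monomial k a) = fun z ↦ a * Λ.zetaPow k z := by
  ext z; simp [zetaPoly, Polynomial.lsum]

lemma derivZetaPoly_monomial (k : ℕ) (a : ℂ) :
    Λ.derivZetaPoly (monomial k a) = fun z ↦ a * Λ.derivZetaPow k z := by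
  ext z; simp [derivZetaPoly, Polynomial.lsum]

lemma hasDerivAt_zetaPoly (P : ℂ[X]) {z : ℂ} (hz : z ∉ Λ.lattice) :
    HasDerivAt (Λ.zetaPoly P) (Λ.derivZetaPoly P z) z := by
  induction P using Polynomial.induction_on' with
  | add P Q hP hQ => simpa only [map_add] using! hP.add hQ
  | monomial k a =>
    rw [zetaPoly_monomial, derivZetaPoly_monomial]
    exact (Λ.hasDerivAt_zetaPow k hz).const_mul a

lemma analyticAt_zetaPoly (P : ℂ[X]) {z : ℂ} (hz : z ∉ Λ.lattice) :
    AnalyticAt ℂ (Λ.zetaPoly P) z :=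
  DifferentiableOn.analyticAt (s := (Λ.lattice : Set ℂ)ᶜ)
    (fun _ hw ↦ (Λ.hasDerivAt_zetaPoly P hw).differentiableAt.differentiableWithinAt)
    (Λ.isOpen_compl_lattice.mem_nhds hz)

lemma derivZetaPoly_add (P : ℂ[X]) (z : ℂ) {l : ℂ} (hl : l ∈ Λ.lattice) :
    Λ.derivZetaPoly P (z + l) = Λ.derivZetaPoly P z := by
  induction P using Polynomial.induction_on' with
  | add P Q hP hQ => simp only [map_add, Pi.add_apply, hP, hQ]
  | monomial k a => simp only [derivZetaPoly_monomial, Λ.derivZetaPow_add k z hl]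

lemma meromorphicAt_derivZetaPoly (P : ℂ[X]) (z : ℂ) : MeromorphicAt (Λ.derivZetaPoly P) z := by
  induction P using Polynomial.induction_on' with
  | add P Q hP hQ => simpa only [map_add] using hP.add hQ
  | monomial k a =>
    rw [derivZetaPoly_monomial]
    exact (MeromorphicAt.const _ _).mul (Λ.meromorphicAt_derivZetaPow k z)

lemma exists_zetaPoly_quasiPeriod {l : ℂ} (hl : l ∈ Λ.lattice) :
    ∃ η : ℂ, ∀ P : ℂ[X], ∀ z ∉ Λ.lattice,
      Λ.zetaPoly P (z + l) = Λ.zetaPoly P z + P.coeff 1 * η := by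
  obtain ⟨η, hη⟩ := Λ.exists_zeta_quasiPeriod hl
  refine ⟨η, fun P z hz ↦ ?_⟩
  induction P using Polynomial.induction_on' with
  | add P Q hP hQ =>
    simp only [map_add, Pi.add_apply, hP, hQ, coeff_add]
    ring
  | monomial k a =>
    simp only [zetaPoly_monomial, coeff_monomial]
    match k with
    | 0 => simp [zetaPow]
    | 1 => simp only [zetaPow, hη z hz, if_true]; ring
    | k + 2 => simp [zetaPow, Λ.derivZetaPow_add (k + 1) z hl]

lemma hasPP_zetaPoly_zero (P : ℂ[X]) : HasPP (Λ.zetaPoly P) 0 P := by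
  induction P using Polynomial.induction_on' with
  | add P Q hP hQ => simpa only [map_add] using! hP.add hQ
  | monomial k a =>
    rw [zetaPoly_monomial, ← mul_one a, ← smul_eq_mul a 1, ← smul_monomial,
      monomial_one_right_eq_X_pow, smul_eq_mul, mul_one]
    exact (Λ.hasPP_zetaPow k).const_mul a

lemma hasPP_zetaPoly (P : ℂ[X]) {l : ℂ} (hl : l ∈ Λ.lattice) : HasPP (Λ.zetaPoly P) l P := by
  obtain ⟨η, hη⟩ := Λ.exists_zetaPoly_quasiPeriod hl
  have h := (Λ.hasPP_zetaPoly_zero P).comp_sub_const (s := l)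
  rw [zero_add] at h
  have h2 := h.add (hasPP_zero.mpr (analyticAt_const (v := P.coeff 1 * η) (x := l)).extAnalyticAt)
  rw [add_zero] at h2
  refine h2.congr ((Λ.eventually_sub_notMem_lattice l l).mono fun z hz ↦ ?_)
  dsimp only
  rw [← hη P _ hz, sub_add_cancel]

end PeriodPair

section Elliptic

variable {L : Set ℂ} {s : ℂ} {R : Set ℂ} {f g : ℂ → ℂ}

lemma IsLattice.exists_periodPair (hL : IsLattice L) :
    ∃ Λ : PeriodPair, L = (Λ.lattice : Set ℂ) := by
  obtain ⟨ω₁, ω₂, hω, rfl⟩ := hL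
  refine ⟨⟨ω₁, ω₂, hω⟩, ?_⟩
  ext z
  simp [PeriodPair.mem_lattice, eq_comm]

lemma IsElliptic.analyticAt_add (hf : IsElliptic L f) {l z : ℂ} (hl : l ∈ L)
    (hz : AnalyticAt ℂ f z) : AnalyticAt ℂ f (z + l) := by
  have hz' : AnalyticAt ℂ f (z + l - l) := by simpa using hz
  have h : AnalyticAt ℂ (fun w ↦ f (w - l)) (z + l) :=
    AnalyticAt.fun_comp (g := f) hz' (by fun_prop)
  refine h.congr ?_
  have ht : Tendsto (fun w : ℂ ↦ w - l) (𝓝 (z + l)) (𝓝 (z + l - l)) :=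
    (continuous_sub_right l).tendsto _
  filter_upwards [ht.eventually hz'.eventually_analyticAt] with w hw
  rw [← hf.2 l hl _ hw, sub_add_cancel]

lemma IsElliptic.eventually_add_eq (hf : IsElliptic L f) {l : ℂ} (hl : l ∈ L) (α : ℂ) :
    ∀ᶠ z in 𝓝[≠] α, f (z + l) = f z :=
  (hf.1 α trivial).eventually_analyticAt.mono fun z hz ↦ hf.2 l hl z hz

lemma HasPP.add_period (hf : IsElliptic L f) {l α : ℂ} (hl : l ∈ L) {P : ℂ[X]}
    (h : HasPP f α P) : HasPP f (α + l) P := by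
  refine h.comp_sub_const.congr ?_
  have := (tendsto_add_const_nhdsNE (α + l) (-l)).eventually
    (hf.eventually_add_eq hl (α + l + -l))
  filter_upwards [this] with z hz
  rw [neg_add_cancel_right] at hz
  rw [hz, sub_eq_add_neg]

lemma IsCompact.finite_inter_not_analyticAt {K : Set ℂ} (hK : IsCompact K)
    (hf : MeromorphicOn f Set.univ) : (K ∩ {z | ¬ AnalyticAt ℂ f z}).Finite := by
  by_contra hinf
  obtain ⟨x, -, hx⟩ := Set.Infinite.exists_accPt_of_subset_isCompact hinf hK inter_subset_left
  rw [accPt_iff_frequently_nhdsNE] at hx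
  exact hx ((hf x trivial).eventually_analyticAt.mono fun z hz h ↦ h.2 hz)

lemma IsPinning.eq_of_sub_mem {Λ : PeriodPair} (hR : IsPinning (Λ.lattice : Set ℂ) s R) {r r' : ℂ}
    {n n' : ℤ} (hr : r ∈ R) (hr' : r' ∈ R) (h : r + n * s - (r' + n' * s) ∈ Λ.lattice) :
    r = r' ∧ n = n' := by
  have := (hR (r + n * s)).unique (y₁ := (r, n, 0))
    (y₂ := (r', n', r + n * s - (r' + n' * s))) ⟨hr, Λ.lattice.zero_mem, by simp⟩
    ⟨hr', h, by simp⟩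
  simp only [Prod.mk.injEq] at this
  exact ⟨this.1, this.2.1⟩

lemma IsPinning.finite_not_analyticAt {Λ : PeriodPair}
    (hR : IsPinning (Λ.lattice : Set ℂ) s R) (hf : IsElliptic (Λ.lattice : Set ℂ) f) :
    {p : ℂ × ℤ | p.1 ∈ R ∧ ¬ AnalyticAt ℂ f (p.1 + p.2 * s)}.Finite := by
  have hK : IsCompact (closure (ZSpan.fundamentalDomain Λ.basis)) :=
    (ZSpan.fundamentalDomain_isBounded _).isCompact_closure
  have hfloor (z : ℂ) : (ZSpan.floor Λ.basis z : ℂ) ∈ Λ.lattice := by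
    rw [Λ.lattice_eq_span_range_basis]
    exact (ZSpan.floor Λ.basis z).2
  refine Set.Finite.of_injOn (f := fun p : ℂ × ℤ ↦ ZSpan.fract Λ.basis (p.1 + p.2 * s))
    ?_ ?_ (hK.finite_inter_not_analyticAt hf.1)
  · rintro p ⟨-, hp⟩
    refine ⟨subset_closure (ZSpan.fract_mem_fundamentalDomain _ _), fun h ↦ hp ?_⟩
    have := hf.analyticAt_add (hfloor (p.1 + p.2 * s)) h
    simpa only [ZSpan.fract_apply, sub_add_cancel] using! this
  · rintro p ⟨hp, -⟩ q ⟨hq, -⟩ h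
    have := hR.eq_of_sub_mem (n := p.2) (n' := q.2) hp hq (by
      simp only [ZSpan.fract_apply] at h
      rw [show p.1 + p.2 * s - (q.1 + q.2 * s) = (ZSpan.floor Λ.basis (p.1 + p.2 * s) : ℂ) -
        ZSpan.floor Λ.basis (q.1 + q.2 * s) by linear_combination h]
      exact sub_mem (hfloor _) (hfloor _))
    exact Prod.ext this.1 this.2

lemma HasPP.eq_zero_of_analyticAt {α : ℂ} {P : ℂ[X]} (h : HasPP f α P) (hP : P.coeff 0 = 0)
    (hf : AnalyticAt ℂ f α) : P = 0 :=
  h.unique (hasPP_zero.mpr hf.extAnalyticAt) hP (by simp)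

lemma IsPinning.finite_support {Λ : PeriodPair} (hR : IsPinning (Λ.lattice : Set ℂ) s R)
    (hf : IsElliptic (Λ.lattice : Set ℂ) f) {P : ℂ → ℂ[X]} (hP : ∀ α, HasPP f α (P α))
    (hP0 : ∀ α, (P α).coeff 0 = 0) {r : ℂ} (hr : r ∈ R) :
    (Function.support fun n : ℤ ↦ P (r + n * s)).Finite := by
  refine ((hR.finite_not_analyticAt hf).preimage (f := fun n : ℤ ↦ (r, n))
    (fun m _ n _ h ↦ (Prod.ext_iff.mp h).2)).subset fun n hn ↦ ?_
  exact ⟨hr, fun h ↦ hn ((hP _).eq_zero_of_analyticAt (hP0 _) h)⟩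

lemma coeff_finsum {ι : Type*} {u : ι → ℂ[X]} (hu : (Function.support u).Finite) (k : ℕ) :
    (∑ᶠ i, u i).coeff k = ∑ᶠ i, (u i).coeff k :=
  (Polynomial.lcoeff ℂ k).toAddMonoidHom.map_finsum hu

lemma derivative_finsum_eq_zero {u v : ℤ → ℂ[X]} (hu : (Function.support u).Finite)
    (hv : (Function.support v).Finite) (h : ∀ n, -(X ^ 2 * derivative (u n)) = v (n + 1) - v n) :
    derivative (∑ᶠ n, u n) = 0 := by
  let φ : ℂ[X] →+ ℂ[X] :=
    -(AddMonoidHom.mulLeft (X ^ 2)).comp (derivative (R := ℂ)).toAddMonoidHom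
  have hφ (p : ℂ[X]) : φ p = -(X ^ 2 * derivative p) := rfl
  have h1 : φ (∑ᶠ n, u n) = 0 := by
    rw [φ.map_finsum hu]
    simp only [hφ, h]
    have hv' : (Function.support fun n ↦ v (n + 1)).Finite :=
      hv.preimage (add_left_injective (1 : ℤ)).injOn
    rw [finsum_sub_distrib hv' hv, sub_eq_zero]
    exact finsum_comp_equiv (Equiv.addRight (1 : ℤ))
  simpa [hφ] using h1

lemma EllSummable.finsum_eq_zero {Λ : PeriodPair} (hR : IsPinning (Λ.lattice : Set ℂ) s R)
    (hf : IsElliptic (Λ.lattice : Set ℂ) f) {P : ℂ → ℂ[X]} (hP : ∀ α, HasPP f α (P α))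
    (hP0 : ∀ α, (P α).coeff 0 = 0) (h : EllSummable (Λ.lattice : Set ℂ) s (deriv f)) {r : ℂ}
    (hr : r ∈ R) : ∑ᶠ n : ℤ, P (r + n * s) = 0 := by
  obtain ⟨g, hg, hfg⟩ := h
  choose Q hQ0 hQ using fun α ↦ (hg.1 α trivial).exists_hasPP
  have hu := hR.finite_support hf hP hP0 hr
  have hder := derivative_finsum_eq_zero hu (hR.finite_support hg hQ hQ0 hr) fun n ↦ by
    have h1 := (hP (r + n * s)).deriv
      ((hf.1 _ trivial).eventually_analyticAt.mono fun z hz ↦ hz.differentiableAt)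
    have hs : r + n * s + s = r + ((n + 1 : ℤ) : ℂ) * s := by push_cast; ring
    have h2 : HasPP (deriv f) (r + n * s) (Q (r + ((n + 1 : ℤ) : ℂ) * s) - Q (r + n * s)) := by
      rw [← hs]
      refine ((hQ (r + n * s + s)).comp_add_const.sub (hQ (r + n * s))).congr ?_
      filter_upwards [(hg.1 (r + n * s) trivial).eventually_analyticAt,
        (tendsto_add_const_nhdsNE (r + n * s) s).eventually
          (hg.1 (r + n * s + s) trivial).eventually_analyticAt] with z h1 h2
      exact (hfg z h1 h2).symm
    exact h1.unique h2 (by simp) (by simp [hQ0])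
  have h0 := eq_C_of_natDegree_eq_zero (derivative_eq_zero.mp hder)
  rw [coeff_finsum hu] at h0
  simpa [hP0] using h0

lemma exists_entire_of_extAnalyticAt (h : ∀ α, ExtAnalyticAt f α) :
    ∃ u : ℂ → ℂ, Differentiable ℂ u ∧ ∀ α, f =ᶠ[𝓝[≠] α] u := by
  choose v hv hfv using h
  have key (α : ℂ) : (fun z ↦ v z z) =ᶠ[𝓝 α] v α := by
    have h1 : ∀ᶠ z in 𝓝[≠] α, v z z = v α z := by
      filter_upwards [eventually_eventually_nhdsWithin.mpr (hfv α), self_mem_nhdsWithin,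
        (hv α).eventually_analyticAt.filter_mono nhdsWithin_le_nhds] with z hz hzα han
      rw [isOpen_compl_singleton.nhdsWithin_eq hzα] at hz
      have : v z =ᶠ[𝓝[≠] z] v α := by
        filter_upwards [hfv z, hz.filter_mono nhdsWithin_le_nhds] with w h1 h2
        rw [← h1, ← h2]
      exact ((hv z).continuousAt.eventuallyEq_nhds_iff_eventuallyEq_nhdsNE
        han.continuousAt |>.mp this).eq_of_nhds
    rw [eventually_nhdsWithin_iff] at h1
    filter_upwards [h1] with z hz
    rcases eq_or_ne z α with rfl | hne
    · rfl
    · exact hz hne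
  refine ⟨fun z ↦ v z z, fun α ↦ ((hv α).congr (key α).symm).differentiableAt, fun α ↦ ?_⟩
  exact Filter.EventuallyEq.trans (hfv α) ((key α).symm.filter_mono nhdsWithin_le_nhds)

lemma exists_const_of_extAnalyticAt (Λ : PeriodPair) (h : ∀ α, ExtAnalyticAt f α)
    (hp : ∀ l ∈ Λ.lattice, ∀ α, ∀ᶠ z in 𝓝[≠] α, f (z + l) = f z) :
    ∃ a : ℂ, ∀ α, f =ᶠ[𝓝[≠] α] fun _ ↦ a := by
  obtain ⟨u, hu, hfu⟩ := exists_entire_of_extAnalyticAt h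
  have hup (z l : ℂ) (hl : l ∈ Λ.lattice) : u (z + l) = u z := by
    have : (fun w ↦ u (w + l)) =ᶠ[𝓝[≠] z] u := by
      filter_upwards [hfu z, hp l hl z,
        (tendsto_add_const_nhdsNE z l).eventually (hfu (z + l))] with w h1 h2 h3
      rw [← h1, ← h2, ← h3]
    exact ((hu.continuous.comp (continuous_add_const l)).continuousAt
      |>.eventuallyEq_nhds_iff_eventuallyEq_nhdsNE hu.continuous.continuousAt |>.mp
        this).eq_of_nhds
  have hb := (IsZLattice.isCompact_range_of_periodic Λ.lattice u hu.continuous hup).isBounded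
  refine ⟨u 0, fun α ↦ ?_⟩
  filter_upwards [hfu α] with z hz
  rw [hz, hu.apply_eq_apply_of_bounded hb z 0]

end Elliptic

section Summation

variable {L : Set ℂ} {s : ℂ} {R : Set ℂ} {f G : ℂ → ℂ}

lemma sum_eq_zero_of_finsum_fiber_eq_zero {ι κ A M : Type*} [AddCommMonoid A] [AddCommMonoid M]
    {T : ι × κ → A} (hT : (Function.support T).Finite) (h : ∀ i, ∑ᶠ j, T (i, j) = 0)
    (F : ι → A →+ M) : ∑ b ∈ hT.toFinset, F b.1 (T b) = 0 := by
  have hsub : (Function.support fun b ↦ F b.1 (T b)) ⊆ Function.support T := fun b hb hb' ↦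
    hb (by simp [hb'])
  rw [← finsum_eq_sum_of_support_subset (fun b ↦ F b.1 (T b)) (by simpa using hsub),
    finsum_curry _ (hT.subset hsub)]
  refine finsum_eq_zero_of_forall_eq_zero fun i ↦ ?_
  have hi : (Function.support fun j ↦ T (i, j)).Finite :=
    hT.preimage (f := fun j ↦ (i, j)) (fun _ _ _ _ h ↦ (Prod.ext_iff.mp h).2)
  simpa [h] using ((F i).map_finsum hi).symm

lemma MeromorphicOn.comp_sub_const_univ {W : ℂ → ℂ} (hW : MeromorphicOn W univ) (a : ℂ) :
    MeromorphicOn (fun z ↦ W (z - a)) univ := fun z _ ↦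
  (hW (z - a) trivial).comp_analyticAt (g := fun z ↦ z - a) (by fun_prop)

/-- A difference of two translates of `W` by multiples of `s` is a telescoping sum. -/
lemma exists_telescope {W : ℂ → ℂ} (hW : MeromorphicOn W univ)
    (hp : ∀ l ∈ L, ∀ z, W (z + l) = W z) (n : ℤ) :
    ∃ G : ℂ → ℂ, MeromorphicOn G univ ∧ (∀ l ∈ L, ∀ z, G (z + l) = G z) ∧
      ∀ z, W (z - n * s) - W z = G (z + s) - G z := by
  induction n using Int.induction_on with
  | zero => exact ⟨0, fun z _ ↦ .const 0 z, by simp, by simp⟩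
  | succ n ih =>
    obtain ⟨G, hG, hGp, hGW⟩ := ih
    refine ⟨fun z ↦ G z - W (z - (n + 1) * s),
      fun z hz ↦ (hG z hz).sub (hW.comp_sub_const_univ _ z hz), fun l hl z ↦ ?_, fun z ↦ ?_⟩
    · simp only [hGp l hl, add_sub_right_comm _ l, hp l hl]
    · have h := hGW z
      dsimp only
      rw [show z + s - (n + 1) * s = z - (n : ℤ) * s by push_cast; ring]
      push_cast at h ⊢
      linear_combination h
  | pred n ih =>
    obtain ⟨G, hG, hGp, hGW⟩ := ih
    refine ⟨fun z ↦ G z + W (z - -n * s),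
      fun z hz ↦ (hG z hz).add (hW.comp_sub_const_univ _ z hz), fun l hl z ↦ ?_, fun z ↦ ?_⟩
    · simp only [hGp l hl, add_sub_right_comm _ l, hp l hl]
    · have h := hGW z
      dsimp only
      rw [show z + s - -n * s = z - (-n - 1 : ℤ) * s by push_cast; ring]
      push_cast at h ⊢
      linear_combination h

open Classical in
/-- It suffices to solve the summation equation away from a discrete set: the solution can be
modified at the poles of `f` so as not to be analytic there. -/
lemma IsElliptic.ellSummable_deriv (hf : IsElliptic L f)
    (hG : MeromorphicOn G univ) (hGp : ∀ l ∈ L, ∀ z, G (z + l) = G z)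
    (h : ∀ α, ∀ᶠ z in 𝓝[≠] α, deriv f z = G (z + s) - G z) : EllSummable L s (deriv f) := by
  have hGe : IsElliptic L G := ⟨hG, fun l hl z _ ↦ hGp l hl z⟩
  let g : ℂ → ℂ := fun z ↦ if ¬ AnalyticAt ℂ f z ∧ AnalyticAt ℂ G z then G z + 1 else G z
  have hgG (α : ℂ) : G =ᶠ[𝓝[≠] α] g :=
    (hf.1 α trivial).eventually_analyticAt.mono fun z hz ↦ (if_neg fun h ↦ h.1 hz).symm
  have hfg {z : ℂ} (hz : AnalyticAt ℂ g z) : AnalyticAt ℂ f z := by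
    by_contra hfz
    by_cases hGz : AnalyticAt ℂ G z
    · have := ((hGz.continuousAt.eventuallyEq_nhds_iff_eventuallyEq_nhdsNE
        hz.continuousAt).mp (hgG z)).eq_of_nhds
      simp [g, hfz, hGz] at this
    · refine hGz (hz.congr ?_)
      have h1 := eventually_nhdsWithin_iff.mp (hgG z)
      filter_upwards [h1] with w hw
      rcases eq_or_ne w z with rfl | hne
      · simp [g, hGz]
      · exact (hw hne).symm
  have hgG' {z : ℂ} (hz : AnalyticAt ℂ g z) : g =ᶠ[𝓝 z] G :=
    (hfg hz).eventually_analyticAt.mono fun w hw ↦ if_neg fun h ↦ h.1 hw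
  refine ⟨g, ⟨fun z hz ↦ (hG z hz).congr (hgG z), fun l hl z hz ↦ ?_⟩, fun z hz hzs ↦ ?_⟩
  · have h1 : g (z + l) = G (z + l) := if_neg fun h ↦ h.1 (hf.analyticAt_add hl (hfg hz))
    rw [h1, hGp l hl, (hgG' hz).eq_of_nhds]
  · have hGz := hz.congr (hgG' hz)
    have hGzs := hzs.congr (hgG' hzs)
    rw [(hgG' hz).eq_of_nhds, (hgG' hzs).eq_of_nhds]
    have hGc : AnalyticAt ℂ (fun w ↦ G (w + s) - G w) z :=
      (AnalyticAt.fun_comp (g := G) (f := fun w ↦ w + s) hGzs (by fun_prop)).sub hGz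
    exact (((hfg hz).deriv.continuousAt.eventuallyEq_nhds_iff_eventuallyEq_nhdsNE
      hGc.continuousAt).mp (h z)).eq_of_nhds

open Classical in
lemma ellSummable_deriv_of_finsum_eq_zero {Λ : PeriodPair}
    (hR : IsPinning (Λ.lattice : Set ℂ) s R) (hf : IsElliptic (Λ.lattice : Set ℂ) f)
    {P : ℂ → ℂ[X]} (hP : ∀ α, HasPP f α (P α)) (hP0 : ∀ α, (P α).coeff 0 = 0)
    (h : ∀ r ∈ R, ∑ᶠ n : ℤ, P (r + n * s) = 0) :
    EllSummable (Λ.lattice : Set ℂ) s (deriv f) := by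
  let p : ℂ × ℤ → ℂ := fun b ↦ b.1 + b.2 * s
  let T : ℂ × ℤ → ℂ[X] := fun b ↦ if b.1 ∈ R then P (p b) else 0
  have hT : (Function.support T).Finite := by
    refine (hR.finite_not_analyticAt hf).subset fun b hb ↦ ?_
    by_cases hbR : b.1 ∈ R
    · refine ⟨hbR, fun ha ↦ hb ?_⟩
      simp only [T, if_pos hbR]
      exact (hP _).eq_zero_of_analyticAt (hP0 _) ha
    · exact absurd (if_neg hbR) hb
  have hTR {b : ℂ × ℤ} (hb : b ∈ hT.toFinset) : b.1 ∈ R := by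
    by_contra hbR
    exact hT.mem_toFinset.mp hb (if_neg hbR)
  have hTsum (r : ℂ) : ∑ᶠ n, T (r, n) = 0 := by
    by_cases hr : r ∈ R
    · simpa [T, p, hr] using h r hr
    · simp [T, hr]
  let E : ℂ → ℂ := fun z ↦ f z - ∑ b ∈ hT.toFinset, Λ.zetaPoly (T b) (z - p b)
  have hE (α : ℂ) : ExtAnalyticAt E α := by
    obtain ⟨⟨r, n, l⟩, ⟨hr, hl, hα⟩, -⟩ := hR α
    dsimp only at hr hl hα
    have h1 : HasPP f α (P (r + n * s)) := by
      rw [hα]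
      exact (hP _).add_period hf hl
    have h2 : HasPP (fun z ↦ ∑ b ∈ hT.toFinset, Λ.zetaPoly (T b) (z - p b)) α
        (∑ b ∈ hT.toFinset, if b = (r, n) then T b else 0) := by
      refine HasPP.sum fun b hb ↦ ?_
      by_cases hbr : b = (r, n)
      · rw [if_pos hbr]
        have := (Λ.hasPP_zetaPoly (T b) hl).comp_sub_const (s := p b)
        rwa [show l + p b = α by rw [hα, hbr]; simp only [p]; ring] at this
      · rw [if_neg hbr]
        refine hasPP_zero.mpr (AnalyticAt.extAnalyticAt ?_)
        have hn : α - p b ∉ Λ.lattice := fun hm ↦ by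
          have := hR.eq_of_sub_mem (n := b.2) (n' := n) (hTR hb) hr (by
            have := sub_mem hl hm
            rwa [hα, show l - (r + n * s + l - p b) = b.1 + b.2 * s - (r + n * s) by
              simp only [p]; ring] at this)
          exact hbr (Prod.ext this.1 this.2)
        exact AnalyticAt.fun_comp (g := Λ.zetaPoly (T b)) (f := fun z ↦ z - p b)
          (Λ.analyticAt_zetaPoly _ hn) (by fun_prop)
    have h3 : (∑ b ∈ hT.toFinset, if b = (r, n) then T b else 0) = P (r + n * s) := by
      rw [Finset.sum_ite_eq']
      split_ifs with hb
      · simp [T, p, hr]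
      · simpa [T, p, hr, eq_comm] using hb
    rw [h3] at h2
    have := h1.sub h2
    rw [sub_self] at this
    exact hasPP_zero.mp this
  have hnot (α : ℂ) : ∀ᶠ z in 𝓝[≠] α, ∀ b ∈ hT.toFinset, z - p b ∉ Λ.lattice :=
    (Filter.eventually_all_finset _).mpr fun b _ ↦ Λ.eventually_sub_notMem_lattice α (p b)
  have hEp : ∀ l ∈ Λ.lattice, ∀ α, ∀ᶠ z in 𝓝[≠] α, E (z + l) = E z := by
    intro l hl α
    obtain ⟨η, hη⟩ := Λ.exists_zetaPoly_quasiPeriod hl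
    have hres : ∑ b ∈ hT.toFinset, (T b).coeff 1 * η = 0 :=
      sum_eq_zero_of_finsum_fiber_eq_zero hT hTsum fun _ ↦
        (AddMonoidHom.mulRight η).comp (Polynomial.lcoeff ℂ 1).toAddMonoidHom
    filter_upwards [hf.eventually_add_eq hl α, hnot α] with z hz hzn
    simp only [E]
    rw [hz, Finset.sum_congr rfl fun b hb ↦ by
      rw [add_sub_right_comm, hη _ _ (hzn b hb)], Finset.sum_add_distrib, hres, add_zero]
  obtain ⟨a, ha⟩ := exists_const_of_extAnalyticAt Λ hE hEp
  have hderiv (α : ℂ) : ∀ᶠ z in 𝓝[≠] α,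
      deriv f z = ∑ b ∈ hT.toFinset, Λ.derivZetaPoly (T b) (z - p b) := by
    have h1 : f =ᶠ[𝓝[≠] α] fun z ↦ a + ∑ b ∈ hT.toFinset, Λ.zetaPoly (T b) (z - p b) :=
      (ha α).mono fun z hz ↦ sub_eq_iff_eq_add.mp hz
    filter_upwards [Filter.EventuallyEq.deriv_nhdsNE h1, hnot α] with z hz hzn
    rw [hz]
    exact ((HasDerivAt.fun_sum fun b hb ↦
      (Λ.hasDerivAt_zetaPoly (T b) (hzn b hb)).comp_sub_const z (p b)).const_add a).deriv
  choose G hG hGp hGW using fun b : ℂ × ℤ ↦ exists_telescope (L := (Λ.lattice : Set ℂ)) (s := s)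
    (W := fun z ↦ Λ.derivZetaPoly (T b) (z - b.1))
    (MeromorphicOn.comp_sub_const_univ (fun z _ ↦ Λ.meromorphicAt_derivZetaPoly (T b) z) b.1)
    (fun l hl z ↦ by rw [add_sub_right_comm, Λ.derivZetaPoly_add _ _ hl]) b.2
  refine hf.ellSummable_deriv (G := fun z ↦ ∑ b ∈ hT.toFinset, G b z)
    (fun z hz ↦ MeromorphicAt.fun_sum fun b _ ↦ hG b z hz)
    (fun l hl z ↦ Finset.sum_congr rfl fun b _ ↦ hGp b l hl z) fun α ↦ ?_
  filter_upwards [hderiv α] with z hz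
  have h0 : ∑ b ∈ hT.toFinset, Λ.derivZetaPoly (T b) (z - b.1) = 0 :=
    sum_eq_zero_of_finsum_fiber_eq_zero hT hTsum fun r ↦
      (Pi.evalAddMonoidHom (fun _ : ℂ ↦ ℂ) (z - r)).comp Λ.derivZetaPoly.toAddMonoidHom
  rw [hz, ← Finset.sum_sub_distrib, ← sub_zero (∑ b ∈ _, _), ← h0, ← Finset.sum_sub_distrib]
  refine Finset.sum_congr rfl fun b _ ↦ ?_
  rw [← hGW b z, show z - p b = z - b.2 * s - b.1 by simp only [p]; ring]

end Summation

theorem stmt13 (L : Set ℂ) (hL : IsLattice L) (s : ℂ)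
    (hs : ∀ n : ℕ, 1 ≤ n → (n : ℂ) * s ∉ L)
    (R : Set ℂ) (hR : IsPinning L s R)
    (f : ℂ → ℂ) (hf : IsElliptic L f)
    (c : ℂ → ℕ → ℂ) (hc : ∀ α : ℂ, IsPrincPart f α (c α)) :
    EllSummable L s (deriv f) ↔
      ∀ r ∈ R, ∀ k : ℕ, 1 ≤ k → (∑ᶠ n : ℤ, c (r + (n : ℂ) * s) k) = 0 := by
  obtain ⟨Λ, rfl⟩ := hL.exists_periodPair
  choose P hPc hP using fun α ↦ (hc α).exists_hasPP
  have hP0 (α : ℂ) : (P α).coeff 0 = 0 := (hPc α 0).trans (hc α).1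
  have hcoeff {r : ℂ} (hr : r ∈ R) (k : ℕ) :
      (∑ᶠ n : ℤ, P (r + n * s)).coeff k = ∑ᶠ n : ℤ, c (r + n * s) k := by
    simp only [coeff_finsum (hR.finite_support hf hP hP0 hr), hPc]
  refine ⟨fun h r hr k _ ↦ ?_, fun h ↦ ?_⟩
  · rw [← hcoeff hr, h.finsum_eq_zero hR hf hP hP0 hr, coeff_zero]
  · refine ellSummable_deriv_of_finsum_eq_zero hR hf hP hP0 fun r hr ↦ ?_
    ext k
    rw [hcoeff hr, coeff_zero]
    rcases Nat.eq_zero_or_pos k with rfl | hk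
    · exact finsum_eq_zero_of_forall_eq_zero fun n ↦ (hc _).1
    · exact h r hr k hk
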